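/- arXiv:1709.07073 — 3 statements merged into one kernel-verified Lean document; each statement's English description precedes it below -/
import Mathlib

section
/- Let A and Ω be closed, and let f and φ be lower semicontinuous on A. Suppose that one of the following conditions is satisfied: (1) the set {x ∈ A : f(x) < f*} is bounded; (2) there exist c₀ > 0 and δ > 0 such that F(·,c₀) is bounded from below on A and the set {x ∈ A : f(x) < f*, φ(x) < δ} is bounded; (3) there exist c₀ > 0 and a feasible point x₀ of (P) such that the set {x ∈ A : F(x,c₀) ≤ f(x₀)} is bounded; (4) f is coercive on A (f(x_n) → +∞ for every sequence {x_n} ⊆ A with ‖x_n‖ → +∞); (5) there exists c₀ > 0 such that F(·,c₀) is coercive on A; (6) φ is coercive on A and there exists c₀ > 0 such that F(·,c₀) is bounded from below on A. Then the linear penalty function F(x,c) is globally exact if and only if it is locally exact at every globally optimal solution of the problem (P). -/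
open Set Filter Topology

/-- The set of global minimizers of `g` on the set `A`. -/
def minimizersOn {X : Type*} (g : X → EReal) (A : Set X) : Set X :=
  {x ∈ A | ∀ y ∈ A, g x ≤ g y}

/-- The set of globally optimal solutions of the problem (P):
minimize `f x` subject to `x ∈ M`, `x ∈ A`. -/
def optSet {X : Type*} (f : X → EReal) (M A : Set X) : Set X :=
  minimizersOn f (M ∩ A)

/-- The penalty function `F` is globally exact. -/
def GloballyExact {X : Type*} (f : X → EReal) (M A : Set X) (F : X → ℝ → EReal) : Prop :=
  ∃ cs > (0 : ℝ), ∀ c ≥ cs, minimizersOn (fun x => F x c) A = optSet f M A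

/-- The penalty function `F` is locally exact at `x₀`. -/
def LocallyExact {X : Type*} [TopologicalSpace X] (A : Set X)
    (F : X → ℝ → EReal) (x₀ : X) : Prop :=
  ∃ cs > (0 : ℝ), ∃ U ∈ 𝓝 x₀, ∀ c ≥ cs, ∀ x ∈ U ∩ A, F x₀ c ≤ F x c

/-- `F` is a penalty-type separating function. -/
def PenaltyType {X : Type*} [TopologicalSpace X] (f : X → EReal) (M A : Set X)
    (F : X → ℝ → EReal) : Prop :=
  ∃ c₀ > (0 : ℝ), ∀ cseq : ℕ → ℝ, StrictMono cseq → (∀ n, c₀ ≤ cseq n) →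
    Tendsto cseq atTop atTop →
    ∀ xseq : ℕ → X, (∀ n, xseq n ∈ minimizersOn (fun x => F x (cseq n)) A) →
    ∀ x₀ : X, MapClusterPt x₀ atTop xseq → x₀ ∈ optSet f M A

/-- `F` is non-degenerate. -/
def NonDegenerate {X : Type*} [NormedAddCommGroup X] (A : Set X)
    (F : X → ℝ → EReal) : Prop :=
  ∃ c₀ > (0 : ℝ), ∃ R > (0 : ℝ), ∀ c ≥ c₀,
    ∃ x ∈ minimizersOn (fun y => F y c) A, ‖x‖ ≤ R

/-- The linear penalty function `F(x, c) = f(x) + c·φ(x)`. -/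
noncomputable def linPen {X : Type*} (f : X → EReal) (φ : X → EReal) (x : X) (c : ℝ) : EReal :=
  f x + (c : EReal) * φ x

/-- Sublevel sets of a coercive function are bounded. -/
theorem isBounded_sublevel_of_coercive {X : Type*} [NormedAddCommGroup X] {g : X → EReal}
    {A : Set X}
    (hg : ∀ xseq : ℕ → X, (∀ n, xseq n ∈ A) → Tendsto (fun n => ‖xseq n‖) atTop atTop →
      Tendsto (fun n => g (xseq n)) atTop (𝓝 (⊤ : EReal))) (r : ℝ) :
    Bornology.IsBounded {x ∈ A | g x ≤ r} := by
  by_contra hunb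
  have hfar : ∀ n : ℕ, ∃ x ∈ {x ∈ A | g x ≤ r}, (n : ℝ) < ‖x‖ := by
    by_contra! ⟨n, hn⟩
    exact hunb (isBounded_iff_forall_norm_le.2 ⟨n, hn⟩)
  choose x hx hnorm using hfar
  have htend := hg x (fun n => (hx n).1)
    (tendsto_atTop_mono (fun n => (hnorm n).le) tendsto_natCast_atTop_atTop)
  obtain ⟨n, hn⟩ := (htend.eventually (lt_mem_nhds (EReal.coe_lt_top r))).exists
  exact hn.not_ge (hx n).2

section LinearPenalty

variable {X : Type*} {f φ : X → EReal}

theorem linPen_of_eq_zero {x : X} (hx : φ x = 0) (c : ℝ) : linPen f φ x c = f x := by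
  simp [linPen, hx]

theorem linPen_add (x : X) {c d : ℝ} (hc : 0 ≤ c) (hd : 0 ≤ d) :
    linPen f φ x (c + d) = linPen f φ x c + d * φ x := by
  rw [linPen, linPen, EReal.coe_add, EReal.right_distrib_of_nonneg
    (EReal.coe_nonneg.2 hc) (EReal.coe_nonneg.2 hd), add_assoc]

theorem le_linPen {x : X} (hx : 0 ≤ φ x) {c : ℝ} (hc : 0 ≤ c) : f x ≤ linPen f φ x c :=
  le_add_of_nonneg_right (mul_nonneg (EReal.coe_nonneg.2 hc) hx)

theorem linPen_mono {x : X} (hx : 0 ≤ φ x) {c d : ℝ} (hc : 0 ≤ c) (hcd : c ≤ d) :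
    linPen f φ x c ≤ linPen f φ x d := by
  have h := linPen_add (f := f) (φ := φ) x hc (sub_nonneg.2 hcd)
  rw [add_sub_cancel] at h
  rw [h]
  exact le_add_of_nonneg_right (mul_nonneg (EReal.coe_nonneg.2 (sub_nonneg.2 hcd)) hx)

theorem add_mul_le_linPen_add {x : X} {c d m δ : ℝ} (hc : 0 ≤ c) (hd : 0 ≤ d)
    (hm : (m : EReal) ≤ linPen f φ x c) (hδ : (δ : EReal) ≤ φ x) :
    ((m + d * δ : ℝ) : EReal) ≤ linPen f φ x (c + d) := by
  rw [linPen_add x hc hd, EReal.coe_add, EReal.coe_mul]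
  exact add_le_add hm (mul_le_mul_of_nonneg_left hδ (EReal.coe_nonneg.2 hd))

/-- A penalty function that does not fall below the optimal value near the optimal solutions
does not fall below it near any point of `A`, once the penalty parameter is large. -/
theorem exists_nhdsWithin_le_linPen [TopologicalSpace X] {M A : Set X} {r : ℝ}
    (hfbot : ∀ x, f x ≠ ⊥) (hφ : ∀ x, 0 ≤ φ x) (hφ0 : ∀ x, φ x = 0 ↔ x ∈ M)
    (hf : LowerSemicontinuousOn f A) (hφlsc : LowerSemicontinuousOn φ A)
    (hr : ∀ x ∈ M ∩ A, (r : EReal) ≤ f x)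
    (hloc : ∀ x ∈ optSet f M A, LocallyExact A (linPen f φ) x) {x : X} (hxA : x ∈ A) :
    ∃ t ∈ 𝓝[A] x, ∀ᶠ c : ℝ in atTop, ∀ y ∈ t, (r : EReal) ≤ linPen f φ y c := by
  rcases lt_or_ge (r : EReal) (f x) with hlt | hle
  · refine ⟨_, hf x hxA r hlt, ?_⟩
    filter_upwards [eventually_ge_atTop 0] with c hc y hy
    exact (le_of_lt hy).trans (le_linPen (hφ y) hc)
  by_cases hxM : x ∈ M
  · obtain ⟨cs, -, U, hU, h⟩ := hloc x ⟨⟨hxM, hxA⟩, fun y hy => hle.trans (hr y hy)⟩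
    refine ⟨U ∩ A, inter_mem (mem_nhdsWithin_of_mem_nhds hU) self_mem_nhdsWithin, ?_⟩
    filter_upwards [eventually_ge_atTop cs] with c hc y hy
    have hy' := h c hc y hy
    rw [linPen_of_eq_zero ((hφ0 x).2 hxM)] at hy'
    exact (hr x ⟨hxM, hxA⟩).trans hy'
  · have hpos : 0 < φ x := (hφ x).lt_of_ne' (mt (hφ0 x).1 hxM)
    obtain ⟨δ, hδ, hδx⟩ := EReal.lt_iff_exists_real_btwn.1 hpos
    obtain ⟨m, -, hmx⟩ := EReal.lt_iff_exists_real_btwn.1 (bot_lt_iff_ne_bot.2 (hfbot x))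
    have hδ : 0 < δ := EReal.coe_pos.1 hδ
    refine ⟨_, inter_mem (hf x hxA m hmx) (hφlsc x hxA δ hδx), ?_⟩
    filter_upwards [eventually_ge_atTop 0, eventually_ge_atTop ((r - m) / δ)]
      with c hc hcr y hy
    have h := add_mul_le_linPen_add (f := f) (m := m) le_rfl hc
      ((le_of_lt hy.1).trans (le_linPen (hφ y) le_rfl)) (le_of_lt hy.2)
    rw [zero_add] at h
    refine le_trans (EReal.coe_le_coe_iff.2 ?_) h
    linarith [(div_le_iff₀ hδ).1 hcr]

/-- If the penalty function is bounded below by the finite optimal value for some value of the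
penalty parameter, then it is globally exact. -/
theorem globallyExact_of_le_linPen {M A : Set X} {r c₀ : ℝ}
    (hφ : ∀ x, 0 ≤ φ x) (hφ0 : ∀ x, φ x = 0 ↔ x ∈ M) (hc₀ : 0 < c₀)
    {z : X} (hz : z ∈ optSet f M A) (hzr : f z = r)
    (hle : ∀ x ∈ A, (r : EReal) ≤ linPen f φ x c₀) :
    GloballyExact f M A (linPen f φ) := by
  refine ⟨c₀ + 1, by linarith, fun c hc => ?_⟩
  have hopt : ∀ x ∈ M, linPen f φ x c = f x := fun x hx => linPen_of_eq_zero ((hφ0 x).2 hx) c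
  refine Subset.antisymm (fun x hx => ?_) (fun x hx => ?_)
  · have hxz : linPen f φ x c ≤ r := by
      rw [← hzr, ← hopt z hz.1.1]
      exact hx.2 z hz.1.2
    have hxM : x ∈ M := by
      rw [← hφ0]
      refine ((hφ x).eq_or_lt.resolve_right fun hpos => ?_).symm
      obtain ⟨δ, hδ, hδx⟩ := EReal.lt_iff_exists_real_btwn.1 hpos
      have hδ : 0 < δ := EReal.coe_pos.1 hδ
      have h := add_mul_le_linPen_add hc₀.le (sub_nonneg.2 (by linarith : c₀ ≤ c))
        (hle x hx.1) hδx.le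
      rw [add_sub_cancel] at h
      have h' := EReal.coe_le_coe_iff.1 (h.trans hxz)
      nlinarith
    rw [hopt x hxM, ← hzr] at hxz
    exact ⟨⟨hxM, hx.1⟩, fun y hy => hxz.trans (hz.2 y hy)⟩
  · refine ⟨hx.1.2, fun y hy => ?_⟩
    simp only [hopt x hx.1.1]
    calc f x ≤ f z := hx.2 z hz.1
      _ = r := hzr
      _ ≤ linPen f φ y c₀ := hle y hy
      _ ≤ linPen f φ y c := linPen_mono (hφ y) hc₀.le (by linarith)

end LinearPenalty

/-- Corollary to the Localization Principle for Linear Penalty Functions: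
under any of six coercivity/boundedness-type conditions, the linear penalty function
is globally exact iff it is locally exact at every globally optimal solution of (P). -/
theorem linear_penalty_global_exactness_coercivity
    {X : Type*} [NormedAddCommGroup X] [NormedSpace ℝ X] [FiniteDimensional ℝ X]
    (f : X → EReal) (φ : X → EReal) (M A : Set X)
    (hM : M.Nonempty) (hA : A.Nonempty)
    (hfbot : ∀ x, f x ≠ ⊥)
    (hφ : ∀ x, 0 ≤ φ x) (hφ0 : ∀ x, φ x = 0 ↔ x ∈ M)
    (hfeas : ∃ x ∈ M ∩ A, f x < ⊤)
    (hopt : (optSet f M A).Nonempty)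
    (hAcl : IsClosed A) (hΩ : IsClosed (M ∩ A))
    (hf : LowerSemicontinuousOn f A) (hφlsc : LowerSemicontinuousOn φ A)
    (hcond :
      -- (1) the set {x ∈ A : f(x) < f*} is bounded
      (Bornology.IsBounded {x ∈ A | f x < sInf (f '' (M ∩ A))}) ∨
      -- (2) F(·,c₀) is bounded below on A and {x ∈ A : f(x) < f*, φ(x) < δ} is bounded
      (∃ c₀ > (0 : ℝ), ∃ δ > (0 : ℝ),
        (∃ m : ℝ, ∀ x ∈ A, (m : EReal) ≤ linPen f φ x c₀) ∧
        Bornology.IsBounded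
          {x ∈ A | f x < sInf (f '' (M ∩ A)) ∧ φ x < (δ : EReal)}) ∨
      -- (3) {x ∈ A : F(x,c₀) ≤ f(x₀)} is bounded for some feasible x₀
      (∃ c₀ > (0 : ℝ), ∃ x₀ ∈ M ∩ A,
        Bornology.IsBounded {x ∈ A | linPen f φ x c₀ ≤ f x₀}) ∨
      -- (4) f is coercive on A
      (∀ xseq : ℕ → X, (∀ n, xseq n ∈ A) →
        Tendsto (fun n => ‖xseq n‖) atTop atTop →
        Tendsto (fun n => f (xseq n)) atTop (𝓝 (⊤ : EReal))) ∨
      -- (5) F(·,c₀) is coercive on A for some c₀ > 0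
      (∃ c₀ > (0 : ℝ), ∀ xseq : ℕ → X, (∀ n, xseq n ∈ A) →
        Tendsto (fun n => ‖xseq n‖) atTop atTop →
        Tendsto (fun n => linPen f φ (xseq n) c₀) atTop (𝓝 (⊤ : EReal))) ∨
      -- (6) φ is coercive on A and F(·,c₀) is bounded below on A for some c₀ > 0
      ((∀ xseq : ℕ → X, (∀ n, xseq n ∈ A) →
        Tendsto (fun n => ‖xseq n‖) atTop atTop →
        Tendsto (fun n => φ (xseq n)) atTop (𝓝 (⊤ : EReal))) ∧
        ∃ c₀ > (0 : ℝ), ∃ m : ℝ, ∀ x ∈ A, (m : EReal) ≤ linPen f φ x c₀)) :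
    GloballyExact f M A (linPen f φ) ↔
      ∀ x₀ ∈ optSet f M A, LocallyExact A (linPen f φ) x₀ := by
  constructor
  · rintro ⟨cs, hcs, h⟩ x hx
    refine ⟨cs, hcs, univ, univ_mem, fun c hc y hy => ?_⟩
    rw [← h c hc] at hx
    exact hx.2 y hy.2
  intro hloc
  obtain ⟨z, hz⟩ := hopt
  obtain ⟨w, hw, hwtop⟩ := hfeas
  obtain ⟨r, hzr⟩ : ∃ r : ℝ, f z = r :=
    ⟨_, (EReal.coe_toReal ((hz.2 w hw).trans_lt hwtop).ne (hfbot z)).symm⟩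
  have hr : ∀ x ∈ M ∩ A, (r : EReal) ≤ f x := fun x hx => hzr ▸ hz.2 x hx
  have hinf : sInf (f '' (M ∩ A)) = r :=
    (hzr ▸ ⟨mem_image_of_mem f hz.1, forall_mem_image.2 hz.2⟩ :
      IsLeast (f '' (M ∩ A)) (r : EReal)).csInf_eq
  rw [hinf] at hcond
  obtain ⟨c₁, hc₁, hbdd⟩ : ∃ c₁ > (0 : ℝ),
      Bornology.IsBounded {x ∈ A | linPen f φ x c₁ < r} := by
    rcases hcond with h | ⟨c₀, hc₀, δ, hδ, ⟨m, hm⟩, h⟩ | ⟨c₀, hc₀, x₀, hx₀, h⟩ | h |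
      ⟨c₀, hc₀, h⟩ | ⟨h, c₀, hc₀, m, hm⟩
    · exact ⟨1, one_pos, h.subset fun x hx =>
        ⟨hx.1, (le_linPen (hφ x) zero_le_one).trans_lt hx.2⟩⟩
    · have hd : 0 ≤ |r - m| / δ := by positivity
      refine ⟨c₀ + |r - m| / δ, by linarith, h.subset fun x hx => ⟨hx.1,
        (le_linPen (hφ x) (by linarith)).trans_lt hx.2, lt_of_not_ge fun hδx => ?_⟩⟩
      have hlt := (add_mul_le_linPen_add hc₀.le hd (hm x hx.1) hδx).trans_lt hx.2
      rw [EReal.coe_lt_coe_iff, div_mul_cancel₀ _ hδ.ne'] at hlt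
      linarith [le_abs_self (r - m)]
    · exact ⟨c₀, hc₀, h.subset fun x hx => ⟨hx.1, hx.2.le.trans (hr x₀ hx₀)⟩⟩
    · exact ⟨1, one_pos, (isBounded_sublevel_of_coercive h r).subset fun x hx =>
        ⟨hx.1, (le_linPen (hφ x) zero_le_one).trans hx.2.le⟩⟩
    · exact ⟨c₀, hc₀, (isBounded_sublevel_of_coercive h r).subset fun x hx => ⟨hx.1, hx.2.le⟩⟩
    · refine ⟨c₀ + 1, by linarith, (isBounded_sublevel_of_coercive h (r - m)).subset
        fun x hx => ⟨hx.1, le_of_not_gt fun hlt => ?_⟩⟩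
      have h' := (add_mul_le_linPen_add hc₀.le zero_le_one (hm x hx.1) hlt.le).trans_lt hx.2
      rw [EReal.coe_lt_coe_iff] at h'
      linarith
  have : ProperSpace X := FiniteDimensional.proper_real X
  have hcompact : IsCompact (closure {x ∈ A | linPen f φ x c₁ < r}) := hbdd.isCompact_closure
  have hev : ∀ᶠ c : ℝ in atTop, ∀ x ∈ closure {x ∈ A | linPen f φ x c₁ < r} ∩ A,
      (r : EReal) ≤ linPen f φ x c := by
    refine (hcompact.inter_right hAcl).induction_on
      (p := fun s => ∀ᶠ c : ℝ in atTop, ∀ x ∈ s, (r : EReal) ≤ linPen f φ x c)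
      (by simp) (fun s t hst h => h.mono fun c hc x hx => hc x (hst hx))
      (fun s t hs ht => ?_) (fun x hx => ?_)
    · filter_upwards [hs, ht] with c hcs hct x hx
      exact hx.elim (hcs x) (hct x)
    · obtain ⟨t, ht, h⟩ := exists_nhdsWithin_le_linPen hfbot hφ hφ0 hf hφlsc hr hloc hx.2
      exact ⟨t, nhdsWithin_mono x inter_subset_right ht, h⟩
  obtain ⟨c, hc, hcc₁⟩ := (hev.and (eventually_ge_atTop c₁)).exists
  refine globallyExact_of_le_linPen hφ hφ0 (hc₁.trans_le hcc₁) hz hzr fun x hx => ?_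
  by_contra! hlt
  exact hlt.not_ge (hc x
    ⟨subset_closure ⟨hx, (linPen_mono (hφ x) hc₁.le hcc₁).trans_lt hlt⟩, hx⟩)
end

section
/- Let x* be a locally optimal solution of the problem (P) such that f(x*) > 0. Suppose that f is Hölder continuous with exponent α ∈ (0,1] in a neighbourhood of x*, and that there exist τ > 0 and r > 0 such that φ(x) ≥ τ·dist(x,Ω)^α for all x ∈ A with ‖x − x*‖ < r. Suppose also that there exist t₀ > 0 and c₀ > 0 such that Q(f(x*) − t, c₀t) ≥ Q(f(x*), 0) for all t ∈ [0, t₀). Then the nonlinear penalty function F(x,c) = Q(f(x), cφ(x)) is locally exact at x*. -/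
open Set Filter Topology

/-- The nonlinear penalty function `F(x, c) = Q(f(x), c·φ(x))`. -/
noncomputable def nonlinPen {X : Type*} (Q : EReal → EReal → EReal)
    (f : X → EReal) (φ : X → EReal) (x : X) (c : ℝ) : EReal :=
  Q (f x) ((c : EReal) * φ x)

/-- The standing assumptions on the convolution function
`Q : [0,+∞]² → (−∞,+∞]`: its restriction to `[0,+∞)²` is strictly monotone,
`Q(+∞, s) = Q(t, +∞) = +∞`, and `Q` never takes the value `−∞` on `[0,+∞]²`. -/
structure QAssumptions (Q : EReal → EReal → EReal) : Prop where
  mono : ∀ t₁ s₁ t₂ s₂ : EReal, 0 ≤ t₁ → 0 ≤ s₁ → t₁ ≤ t₂ → s₁ ≤ s₂ →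
    t₂ < ⊤ → s₂ < ⊤ → ¬(t₁ = t₂ ∧ s₁ = s₂) → Q t₁ s₁ < Q t₂ s₂
  top_left : ∀ s : EReal, 0 ≤ s → Q ⊤ s = ⊤
  top_right : ∀ t : EReal, 0 ≤ t → Q t ⊤ = ⊤
  ne_bot : ∀ t s : EReal, 0 ≤ t → 0 ≤ s → Q t s ≠ ⊥

/-- A convolution function is monotone on the whole of `[0,+∞]²`. -/
theorem QAssumptions.le_of_le {Q : EReal → EReal → EReal} (hQ : QAssumptions Q)
    {t₁ s₁ t₂ s₂ : EReal} (ht₁ : 0 ≤ t₁) (hs₁ : 0 ≤ s₁) (ht : t₁ ≤ t₂) (hs : s₁ ≤ s₂) :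
    Q t₁ s₁ ≤ Q t₂ s₂ := by
  rcases eq_or_ne t₂ ⊤ with rfl | ht₂
  · rw [hQ.top_left _ (hs₁.trans hs)]
    exact le_top
  rcases eq_or_ne s₂ ⊤ with rfl | hs₂
  · rw [hQ.top_right _ (ht₁.trans ht)]
    exact le_top
  by_cases h : t₁ = t₂ ∧ s₁ = s₂
  · rw [h.1, h.2]
  · exact (hQ.mono _ _ _ _ ht₁ hs₁ ht hs ht₂.lt_top hs₂.lt_top h).le

/-- A bound `t ≤ L * ‖x - y‖ ^ α` valid for all points `y` of `S` close to `x` passes to the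
distance from `x` to `S`, provided that this distance is small. -/
theorem le_mul_infDist_rpow {X : Type*} [NormedAddCommGroup X] {S : Set X} (hS : S.Nonempty)
    {x : X} {t L α ρ : ℝ} (hL : 0 ≤ L) (hα : 0 < α) (hρ : Metric.infDist x S < ρ)
    (h : ∀ y ∈ S, ‖x - y‖ < ρ → t ≤ L * ‖x - y‖ ^ α) :
    t ≤ L * Metric.infDist x S ^ α := by
  have hcont : Tendsto (fun δ : ℝ => L * δ ^ α) (𝓝[>] Metric.infDist x S)
      (𝓝 (L * Metric.infDist x S ^ α)) :=
    ((Real.continuousAt_rpow_const _ _ (Or.inr hα.le)).const_mul L).tendsto.mono_left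
      nhdsWithin_le_nhds
  refine ge_of_tendsto hcont ?_
  filter_upwards [Ioo_mem_nhdsGT hρ] with δ hδ
  obtain ⟨y, hy, hyδ⟩ := (Metric.infDist_lt_iff hS).1 hδ.1
  rw [dist_eq_norm] at hyδ
  refine (h y hy (hyδ.trans hδ.2)).trans ?_
  gcongr

/-- Sufficient conditions for the local exactness of the nonlinear penalty function
at a locally optimal solution `x*` of (P) with `f(x*) > 0`. -/
theorem nonlinear_penalty_local_exactness
    {X : Type*} [NormedAddCommGroup X] [NormedSpace ℝ X] [FiniteDimensional ℝ X]
    (Q : EReal → EReal → EReal) (f : X → EReal) (φ : X → EReal) (M A : Set X)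
    (hM : M.Nonempty) (hA : A.Nonempty)
    (hQ : QAssumptions Q)
    (hfnn : ∀ x, 0 ≤ f x)
    (hφ : ∀ x, 0 ≤ φ x) (hφ0 : ∀ x, φ x = 0 ↔ x ∈ M)
    (α : ℝ) (hα : 0 < α) (hα1 : α ≤ 1)
    (xs : X)
    -- x* is a locally optimal solution of (P) with f(x*) > 0
    (hxs : xs ∈ M ∩ A)
    (hlocopt : ∃ U ∈ 𝓝 xs, ∀ x ∈ U ∩ (M ∩ A), f xs ≤ f x)
    (hfxs : 0 < f xs)
    -- f is Hölder continuous with exponent α in a neighbourhood of x*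
    (hHolder : ∃ ε > (0 : ℝ), ∃ L ≥ (0 : ℝ), ∀ x ∈ Metric.ball xs ε,
      ∀ y ∈ Metric.ball xs ε, f x ≤ f y + ((L * ‖x - y‖ ^ α : ℝ) : EReal))
    -- error bound: φ(x) ≥ τ ⋅ dist(x, Ω)^α for x ∈ A with ‖x − x*‖ < r
    (herr : ∃ τ > (0 : ℝ), ∃ r > (0 : ℝ), ∀ x ∈ A, ‖x - xs‖ < r →
      ((τ * (Metric.infDist x (M ∩ A)) ^ α : ℝ) : EReal) ≤ φ x)
    -- Q(f(x*) − t, c₀ t) ≥ Q(f(x*), 0) for all t ∈ [0, t₀)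
    (hQcond : ∃ t₀ > (0 : ℝ), ∃ c₀ > (0 : ℝ), ∀ t : ℝ, 0 ≤ t → t < t₀ →
      Q (f xs) 0 ≤ Q (f xs - (t : EReal)) ((c₀ * t : ℝ) : EReal)) :
    LocallyExact A (nonlinPen Q f φ) xs := by
  obtain ⟨V, hV, hopt⟩ := hlocopt
  obtain ⟨η, hη, hηV⟩ := Metric.mem_nhds_iff.1 hV
  obtain ⟨ε, hε, L, hL, hH⟩ := hHolder
  obtain ⟨τ, hτ, r, hr, herr⟩ := herr
  obtain ⟨t₀, ht₀, c₀, hc₀, hQc⟩ := hQcond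
  have hsmall : ∀ᶠ x in 𝓝 xs, L * ‖xs - x‖ ^ α < t₀ := by
    have hc : Continuous fun x : X => L * ‖xs - x‖ ^ α :=
      continuous_const.mul
        ((continuous_const.sub continuous_id).norm.rpow_const fun _ => Or.inr hα.le)
    refine hc.continuousAt.eventually_lt continuousAt_const ?_
    simpa [Real.zero_rpow hα.ne'] using ht₀
  set ρ := min ε η
  have hρ : 0 < ρ := lt_min hε hη
  refine ⟨c₀ * L / τ + 1, by positivity, _, inter_mem hsmall
    (inter_mem (Metric.ball_mem_nhds xs (half_pos hρ)) (Metric.ball_mem_nhds xs hr)), ?_⟩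
  rintro c hc x ⟨⟨hxt, hxρ, hxr⟩, hxA⟩
  have hxρ' : dist x xs < ρ / 2 := hxρ
  have hxε : x ∈ Metric.ball xs ε := Metric.mem_ball.2 (by linarith [min_le_left ε η])
  have hc0 : 0 < c := lt_of_lt_of_le (by positivity) hc
  have hcφ : 0 ≤ (c : EReal) * φ x := mul_nonneg (by exact_mod_cast hc0.le) (hφ x)
  have hφxs : φ xs = 0 := (hφ0 xs).2 hxs.1
  simp only [nonlinPen, hφxs, mul_zero]
  rcases le_or_gt (f xs) (f x) with hle | hlt
  · exact hQ.le_of_le hfxs.le le_rfl hle hcφ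
  have hxsx := hH xs (Metric.mem_ball_self hε) x hxε
  obtain ⟨a, ha⟩ : ∃ a : ℝ, f x = a :=
    ⟨_, (EReal.coe_toReal hlt.ne_top (ne_bot_of_le_ne_bot EReal.zero_ne_bot (hfnn x))).symm⟩
  have hxs_top : f xs ≠ ⊤ := by
    rintro htop
    rw [htop, ha, ← EReal.coe_add] at hxsx
    exact EReal.coe_ne_top _ (top_le_iff.1 hxsx)
  obtain ⟨b, hb⟩ : ∃ b : ℝ, f xs = b :=
    ⟨_, (EReal.coe_toReal hxs_top hlt.ne_bot).symm⟩
  rw [ha, hb, EReal.coe_lt_coe_iff] at hlt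
  rw [ha, hb, ← EReal.coe_add, EReal.coe_le_coe_iff] at hxsx
  have hd : b - a ≤ L * Metric.infDist x (M ∩ A) ^ α := by
    refine le_mul_infDist_rpow ⟨xs, hxs⟩ hL hα
      ((Metric.infDist_le_dist_of_mem hxs).trans_lt hxρ') fun y hy hxy => ?_
    have hyρ : dist y xs < ρ := by
      rw [← dist_eq_norm, dist_comm] at hxy
      linarith [dist_triangle y x xs]
    have hxsy := hopt y ⟨hηV (Metric.mem_ball.2 (hyρ.trans_le (min_le_right _ _))), hy⟩
    have hyx := hxsy.trans
      (hH y (Metric.mem_ball.2 (hyρ.trans_le (min_le_left _ _))) x hxε)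
    rw [ha, hb, ← EReal.coe_add, EReal.coe_le_coe_iff, norm_sub_rev] at hyx
    linarith
  have hφx := herr x hxA (by simpa [dist_eq_norm] using hxr)
  have hpen : ((c₀ * (b - a) : ℝ) : EReal) ≤ c * φ x := by
    refine le_trans ?_ (mul_le_mul_of_nonneg_left hφx (by exact_mod_cast hc0.le))
    rw [← EReal.coe_mul, EReal.coe_le_coe_iff]
    have hdα : 0 ≤ Metric.infDist x (M ∩ A) ^ α := Real.rpow_nonneg Metric.infDist_nonneg _
    have hcτ : c₀ * L ≤ c * τ := by
      rw [← div_le_iff₀ hτ]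
      linarith
    calc c₀ * (b - a) ≤ c₀ * (L * Metric.infDist x (M ∩ A) ^ α) := by gcongr
      _ = c₀ * L * Metric.infDist x (M ∩ A) ^ α := by ring
      _ ≤ c * τ * Metric.infDist x (M ∩ A) ^ α := by gcongr
      _ = c * (τ * Metric.infDist x (M ∩ A) ^ α) := by ring
  have hbase := hQc (b - a) (by linarith) (by linarith [show L * ‖xs - x‖ ^ α < t₀ from hxt])
  have hab : f xs - ((b - a : ℝ) : EReal) = f x := by
    rw [ha, hb, ← EReal.coe_sub, sub_sub_cancel]
  rw [hab] at hbase
  refine hbase.trans (hQ.le_of_le (hfnn x) ?_ le_rfl hpen)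
  exact_mod_cast mul_nonneg hc₀.le (sub_nonneg.2 hlt.le)
end

section
/- For the nonlinear penalty function F(x,c) = Q(f(x), cφ(x)): if Ω* ∩ argmin_{x∈A} F(x,c₀) ≠ ∅ for some c₀ > 0, then for every c > c₀ one has argmin_{x∈A} F(x,c) = Ω*; in particular, the condition Ω* ∩ argmin_{x∈A} F(x,c₀) ≠ ∅ for some c₀ > 0 is equivalent to the global exactness of F. -/
open Set Filter Topology

theorem QAssumptions.lt_top {Q : EReal → EReal → EReal} (hQ : QAssumptions Q) {t s : EReal}
    (ht : 0 ≤ t) (hs : 0 ≤ s) (ht' : t < ⊤) (hs' : s < ⊤) : Q t s < ⊤ := by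
  lift t to ℝ using ⟨ht'.ne, fun h => by simp [h] at ht⟩
  have hlt : (t : EReal) < ((t + 1 : ℝ) : EReal) := EReal.coe_lt_coe_iff.2 (lt_add_one t)
  exact (hQ.mono _ _ _ _ ht hs hlt.le le_rfl (EReal.coe_lt_top _) hs'
    fun h => hlt.ne h.1).trans_le le_top

theorem nonlinPen_of_mem {X : Type*} {Q : EReal → EReal → EReal} {f φ : X → EReal} {M : Set X}
    (hφ0 : ∀ x, φ x = 0 ↔ x ∈ M) {x : X} (hx : x ∈ M) (c : ℝ) :
    nonlinPen Q f φ x c = Q (f x) 0 := by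
  simp [nonlinPen, (hφ0 x).2 hx]

/-- Outside of the feasible region a finite penalty function strictly increases with the penalty
parameter. -/
theorem nonlinPen_lt_nonlinPen {X : Type*} {Q : EReal → EReal → EReal} {f φ : X → EReal}
    (hQ : QAssumptions Q) {x : X} (hf : 0 ≤ f x) (hf' : f x < ⊤) (hφ : 0 < φ x) (hφ' : φ x < ⊤)
    {c₀ c : ℝ} (hc₀ : 0 < c₀) (hc : c₀ < c) : nonlinPen Q f φ x c₀ < nonlinPen Q f φ x c := by
  unfold nonlinPen
  generalize φ x = p at *
  lift p to ℝ using ⟨hφ'.ne, fun h => by simp [h] at hφ⟩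
  have hp : 0 < p := EReal.coe_pos.1 hφ
  have hlt : (c₀ : EReal) * p < c * p := by
    rw [← EReal.coe_mul, ← EReal.coe_mul]
    exact EReal.coe_lt_coe_iff.2 (mul_lt_mul_of_pos_right hc hp)
  refine hQ.mono _ _ _ _ hf ?_ le_rfl hlt.le hf' ?_ fun h => hlt.ne h.2
  · rw [← EReal.coe_mul]
    exact EReal.coe_nonneg.2 (mul_pos hc₀ hp).le
  · rw [← EReal.coe_mul]
    exact EReal.coe_lt_top _

/-- If an optimal solution minimizes the penalty function for some `c₀`, then for every `c > c₀`
its penalty value is strictly smaller than that of any nonoptimal point. -/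
theorem nonlinPen_lt_of_notMem_optSet {X : Type*} {Q : EReal → EReal → EReal} {f φ : X → EReal}
    {M A : Set X} (hQ : QAssumptions Q) (hfnn : ∀ x, 0 ≤ f x) (hφ : ∀ x, 0 ≤ φ x)
    (hφ0 : ∀ x, φ x = 0 ↔ x ∈ M) {x : X} (hx : x ∈ optSet f M A) (hfx : f x < ⊤) {c₀ c : ℝ}
    (hc₀ : 0 < c₀) (hc : c₀ < c) (hmin : x ∈ minimizersOn (fun x => nonlinPen Q f φ x c₀) A)
    {y : X} (hy : y ∈ A) (hy' : y ∉ optSet f M A) :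
    nonlinPen Q f φ x c < nonlinPen Q f φ y c := by
  have hxc (d : ℝ) : nonlinPen Q f φ x d = Q (f x) 0 := nonlinPen_of_mem hφ0 hx.1.1 d
  have htop : Q (f x) 0 < ⊤ := hQ.lt_top (hfnn x) le_rfl hfx EReal.zero_lt_top
  rw [hxc]
  rcases eq_or_lt_of_le (le_top (a := f y)) with hfy | hfy
  · have hcy : 0 ≤ (c : EReal) * φ y := mul_nonneg (EReal.coe_nonneg.2 (hc₀.trans hc).le) (hφ y)
    rwa [nonlinPen, hfy, hQ.top_left _ hcy]
  by_cases hyM : y ∈ M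
  · rw [nonlinPen_of_mem hφ0 hyM]
    refine hQ.mono _ _ _ _ (hfnn x) le_rfl (hx.2 y ⟨hyM, hy⟩) le_rfl hfy EReal.zero_lt_top
      fun h => hy' ⟨⟨hyM, hy⟩, fun z hz => h.1 ▸ hx.2 z hz⟩
  rcases eq_or_lt_of_le (le_top (a := φ y)) with hφy | hφy
  · rwa [nonlinPen, hφy, EReal.coe_mul_top_of_pos (hc₀.trans hc), hQ.top_right _ (hfnn y)]
  · have hpos : 0 < φ y := (hφ y).lt_of_ne' fun h => hyM ((hφ0 y).1 h)
    calc Q (f x) 0 = nonlinPen Q f φ x c₀ := (hxc c₀).symm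
      _ ≤ nonlinPen Q f φ y c₀ := hmin.2 y hy
      _ < nonlinPen Q f φ y c := nonlinPen_lt_nonlinPen hQ (hfnn y) hfy hpos hφy hc₀ hc

/-- For the nonlinear penalty function: if some globally optimal solution of (P) is a
global minimizer of `F(·, c₀)` on `A` for some `c₀ > 0`, then for every `c > c₀` the
minimizers of `F(·, c)` on `A` are exactly the globally optimal solutions of (P);
in particular, the existence of such `c₀` is equivalent to global exactness of `F`. -/
theorem nonlinear_penalty_intersection_iff_exactness
    {X : Type*} [NormedAddCommGroup X] [NormedSpace ℝ X] [FiniteDimensional ℝ X]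
    (Q : EReal → EReal → EReal) (f : X → EReal) (φ : X → EReal) (M A : Set X)
    (hM : M.Nonempty) (hA : A.Nonempty)
    (hQ : QAssumptions Q)
    (hfnn : ∀ x, 0 ≤ f x)
    (hφ : ∀ x, 0 ≤ φ x) (hφ0 : ∀ x, φ x = 0 ↔ x ∈ M)
    (hfeas : ∃ x ∈ M ∩ A, f x < ⊤)
    (hopt : (optSet f M A).Nonempty) :
    (∀ c₀ > (0 : ℝ),
      (optSet f M A ∩ minimizersOn (fun x => nonlinPen Q f φ x c₀) A).Nonempty →
      ∀ c > c₀, minimizersOn (fun x => nonlinPen Q f φ x c) A = optSet f M A) ∧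
    ((∃ c₀ > (0 : ℝ),
      (optSet f M A ∩ minimizersOn (fun x => nonlinPen Q f φ x c₀) A).Nonempty) ↔
      GloballyExact f M A (nonlinPen Q f φ)) := by
  have key : ∀ c₀ > (0 : ℝ),
      (optSet f M A ∩ minimizersOn (fun x => nonlinPen Q f φ x c₀) A).Nonempty →
      ∀ c > c₀, minimizersOn (fun x => nonlinPen Q f φ x c) A = optSet f M A := by
    rintro c₀ hc₀ ⟨x, hx, hmin⟩ c hc
    obtain ⟨w, hw, hfw⟩ := hfeas
    have hlt {y : X} (hy : y ∈ A) (hy' : y ∉ optSet f M A) :=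
      nonlinPen_lt_of_notMem_optSet hQ hfnn hφ hφ0 hx ((hx.2 w hw).trans_lt hfw) hc₀ hc hmin hy hy'
    have heq {y z : X} (hy : y ∈ optSet f M A) (hz : z ∈ optSet f M A) :
        nonlinPen Q f φ y c = nonlinPen Q f φ z c := by
      rw [nonlinPen_of_mem hφ0 hy.1.1, nonlinPen_of_mem hφ0 hz.1.1,
        le_antisymm (hy.2 z hz.1) (hz.2 y hy.1)]
    ext z
    refine ⟨fun hz => ?_, fun hz => ⟨hz.1.2, fun y hy => ?_⟩⟩
    · by_contra hz'
      exact (hlt hz.1 hz').not_ge (hz.2 x hx.1.2)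
    · by_cases hy' : y ∈ optSet f M A
      · exact (heq hz hy').le
      · exact (heq hz hx).trans_le (hlt hy hy').le
  refine ⟨key, ?_, ?_⟩
  · rintro ⟨c₀, hc₀, h⟩
    exact ⟨c₀ + 1, by positivity, fun c hc => key c₀ hc₀ h c (by linarith)⟩
  · rintro ⟨c, hc, h⟩
    exact ⟨c, hc, by rwa [h c le_rfl, inter_self]⟩
end
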